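/- arXiv:1901.05631 — 2 statements merged into one kernel-verified Lean document; each statement's English description precedes it below -/
import Mathlib

section
/- Let d, N be positive integers, p ∈ (0,1], C₀ > 0, and S a finite set. Let b : ℝ^d × P(ℝ^d) × S → ℝ^d satisfy |b(x, μ, i)| ≤ C₀(1 + |x| + ∫|y| dμ(y)) for all x ∈ ℝ^d, all Borel probability measures μ on ℝ^d with finite first moment, and all i ∈ S, and let σ : ℝ^d × P(ℝ^d) × S → ℝ^{d×d} satisfy |σ(x, μ, i)| ≤ C₀ (matrix norm). Set a = σσᵀ. Define V : (ℝ^d)^N → ℝ by V(x) = ((1/N)∑_{i=1}^N |x_i|² + 1)^p, and define L_N V(x, i₀) := ∑_{i=1}^N b(x_i, δ_x, i₀) · ∇_{x_i} V(x) + (1/2) ∑_{i=1}^N trace( a(x_i, δ_x, i₀) · Hess_{x_i} V(x) ), where ∇_{x_i} and Hess_{x_i} denote the gradient and Hessian in the i-th coordinate block. Then there exists a constant C₁, depending only on C₀, p and d (in particular independent of N, x and i₀), such that |L_N V(x, i₀)| ≤ C₁ · V(x) for all x ∈ (ℝ^d)^N and all i₀ ∈ S. -/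
open MeasureTheory Matrix
open scoped ENNReal NNReal RealInnerProductSpace

/-- Empirical measure of a tuple `x = (x_1, …, x_N)`. -/
noncomputable def empirical {d : ℕ} (N : ℕ) (x : Fin N → EuclideanSpace ℝ (Fin d)) :
    Measure (EuclideanSpace ℝ (Fin d)) :=
  (N : ℝ≥0∞)⁻¹ • ∑ i : Fin N, Measure.dirac (x i)

/-- The Lyapunov function `V(x) = ((1/N) ∑ |x_i|² + 1)^p`. -/
noncomputable def lyapV (d N : ℕ) (p : ℝ) (x : Fin N → EuclideanSpace ℝ (Fin d)) : ℝ :=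
  ((N : ℝ)⁻¹ * ∑ i, ‖x i‖ ^ 2 + 1) ^ p

/-- Gradient of `V` with respect to the `i`-th coordinate block. -/
noncomputable def blockGrad {d N : ℕ} (V : (Fin N → EuclideanSpace ℝ (Fin d)) → ℝ)
    (x : Fin N → EuclideanSpace ℝ (Fin d)) (i : Fin N) : EuclideanSpace ℝ (Fin d) :=
  gradient (fun v => V (Function.update x i v)) (x i)

/-- `(k, l)` entry of the Hessian of `V` with respect to the `i`-th coordinate block. -/
noncomputable def blockHess {d N : ℕ} (V : (Fin N → EuclideanSpace ℝ (Fin d)) → ℝ)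
    (x : Fin N → EuclideanSpace ℝ (Fin d)) (i : Fin N) (k l : Fin d) : ℝ :=
  fderiv ℝ (fun v => fderiv ℝ (fun w => V (Function.update x i w)) v
      (EuclideanSpace.single l (1:ℝ))) (x i) (EuclideanSpace.single k (1:ℝ))

lemma lyapV_update {d N : ℕ} (p : ℝ) (x : Fin N → EuclideanSpace ℝ (Fin d)) (i : Fin N)
    (v : EuclideanSpace ℝ (Fin d)) :
    lyapV d N p (Function.update x i v) =
      ((N : ℝ)⁻¹ * ‖v‖ ^ 2 + ((N : ℝ)⁻¹ * ∑ j ∈ Finset.univ.erase i, ‖x j‖ ^ 2 + 1)) ^ p := by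
  unfold lyapV
  rw [← Finset.add_sum_erase _ _ (Finset.mem_univ i)]
  have : ∑ j ∈ Finset.univ.erase i, ‖Function.update x i v j‖ ^ 2
      = ∑ j ∈ Finset.univ.erase i, ‖x j‖ ^ 2 := by
    apply Finset.sum_congr rfl
    intro j hj
    rw [Function.update_of_ne (Finset.ne_of_mem_erase hj)]
  rw [this, Function.update_self]
  congr 1
  ring

lemma hasFDerivAt_aux {d : ℕ} (n c p : ℝ) (hn : 0 ≤ n) (hc : 0 < c)
    (v : EuclideanSpace ℝ (Fin d)) :
    HasFDerivAt (fun v : EuclideanSpace ℝ (Fin d) => (n * ‖v‖ ^ 2 + c) ^ p)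
      ((p * (n * ‖v‖ ^ 2 + c) ^ (p - 1) * (2 * n)) • innerSL ℝ v) v := by
  have h1 : HasFDerivAt (fun v : EuclideanSpace ℝ (Fin d) => n * ‖v‖ ^ 2 + c)
      (n • (2 • innerSL ℝ v)) v :=
    ((hasStrictFDerivAt_norm_sq v).hasFDerivAt.const_mul n).add_const c
  have hpos : 0 < n * ‖v‖ ^ 2 + c := by positivity
  have h2 := h1.rpow_const (p := p) (Or.inl hpos.ne')
  refine h2.congr_fderiv ?_
  ext w
  simp
  ring

lemma blockGrad_eq {d N : ℕ} (p : ℝ) (x : Fin N → EuclideanSpace ℝ (Fin d)) (i : Fin N) :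
    blockGrad (lyapV d N p) x i =
      (p * ((N : ℝ)⁻¹ * ∑ i, ‖x i‖ ^ 2 + 1) ^ (p - 1) * (2 * (N : ℝ)⁻¹)) • x i := by
  unfold blockGrad
  apply HasGradientAt.gradient
  rw [hasGradientAt_iff_hasFDerivAt]
  simp_rw [lyapV_update]
  have h := hasFDerivAt_aux (N : ℝ)⁻¹ ((N : ℝ)⁻¹ * ∑ j ∈ Finset.univ.erase i, ‖x j‖ ^ 2 + 1) p
    (by positivity) (by positivity) (x i)
  refine h.congr_fderiv ?_
  rw [← Finset.add_sum_erase _ _ (Finset.mem_univ i)]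
  ext w
  simp
  left; left; left
  congr 1
  ring

lemma blockHess_eq {d N : ℕ} (p : ℝ) (x : Fin N → EuclideanSpace ℝ (Fin d)) (i : Fin N)
    (k l : Fin d) :
    blockHess (lyapV d N p) x i k l =
      p * ((N : ℝ)⁻¹ * ∑ i, ‖x i‖ ^ 2 + 1) ^ (p - 1) * (2 * (N : ℝ)⁻¹) * (if k = l then 1 else 0)
      + p * (p - 1) * ((N : ℝ)⁻¹ * ∑ i, ‖x i‖ ^ 2 + 1) ^ (p - 2) * (2 * (N : ℝ)⁻¹) ^ 2
        * (x i k * x i l) := by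
  unfold blockHess
  simp_rw [lyapV_update]
  set c := (N : ℝ)⁻¹ * ∑ j ∈ Finset.univ.erase i, ‖x j‖ ^ 2 + 1 with hc
  have hcpos : 0 < c := by positivity
  have hA : (N : ℝ)⁻¹ * ∑ i, ‖x i‖ ^ 2 + 1 = (N : ℝ)⁻¹ * ‖x i‖ ^ 2 + c := by
    rw [← Finset.add_sum_erase _ _ (Finset.mem_univ i), hc]; ring
  rw [hA]
  have hn : 0 ≤ (N : ℝ)⁻¹ := by positivity
  generalize (N : ℝ)⁻¹ = n at *
  have h1 : (fun v : EuclideanSpace ℝ (Fin d) => fderiv ℝ (fun w : EuclideanSpace ℝ (Fin d) =>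
      (n * ‖w‖ ^ 2 + c) ^ p) v (EuclideanSpace.single l (1:ℝ)))
      = fun v => (p * (2 * n)) * ((n * ‖v‖ ^ 2 + c) ^ (p - 1) * EuclideanSpace.proj (𝕜 := ℝ) l v) := by
    ext v
    rw [(hasFDerivAt_aux n c p hn hcpos v).fderiv]
    simp [EuclideanSpace.inner_single_right]
    ring
  rw [h1]
  have h2 := ((hasFDerivAt_aux n c (p - 1) hn hcpos (x i)).mul
    (EuclideanSpace.proj (𝕜 := ℝ) l : EuclideanSpace ℝ (Fin d) →L[ℝ] ℝ).hasFDerivAt).const_mul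
      (p * (2 * n))
  refine (congrArg (fun f : EuclideanSpace ℝ (Fin d) →L[ℝ] ℝ =>
    f (EuclideanSpace.single k (1:ℝ))) (HasFDerivAt.fderiv h2)).trans ?_
  have h3 : p - 1 - 1 = p - 2 := by ring
  rw [h3]
  by_cases hkl : k = l
  · subst hkl
    simp [EuclideanSpace.inner_single_right]
    ring
  · simp [EuclideanSpace.inner_single_right, hkl, Ne.symm hkl]
    ring_nf

lemma empirical_prob {d N : ℕ} (hN : 0 < N) (x : Fin N → EuclideanSpace ℝ (Fin d)) :
    IsProbabilityMeasure (empirical N x) := by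
  constructor
  simp [empirical]
  exact ENNReal.inv_mul_cancel (by exact_mod_cast hN.ne') (by simp)

lemma empirical_integrable {d N : ℕ} (hN : 0 < N) (x : Fin N → EuclideanSpace ℝ (Fin d)) :
    Integrable (fun y => ‖y‖) (empirical N x) := by
  unfold empirical
  apply Integrable.smul_measure
  · rw [integrable_finsetSum_measure]
    intro i _
    exact integrable_dirac (by simp)
  · simp [hN.ne']

lemma empirical_integral {d N : ℕ} (x : Fin N → EuclideanSpace ℝ (Fin d)) :
    ∫ y, ‖y‖ ∂(empirical N x) = (N : ℝ)⁻¹ * ∑ i, ‖x i‖ := by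
  unfold empirical
  rw [integral_smul_measure, integral_finsetSum_measure]
  · simp
  · intro i _
    exact integrable_dirac (by simp)

theorem stmt9 {d : ℕ} (hd : 0 < d) (S : Type*) [Fintype S] (p C₀ : ℝ)
    (hp0 : 0 < p) (hp1 : p ≤ 1) (hC₀ : 0 < C₀) :
    ∃ C₁ : ℝ,
      ∀ (b : EuclideanSpace ℝ (Fin d) → Measure (EuclideanSpace ℝ (Fin d)) → S →
          EuclideanSpace ℝ (Fin d))
        (σm : EuclideanSpace ℝ (Fin d) → Measure (EuclideanSpace ℝ (Fin d)) → S →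
          Matrix (Fin d) (Fin d) ℝ),
        (∀ x μ i, IsProbabilityMeasure μ → Integrable (fun y => ‖y‖) μ →
          ‖b x μ i‖ ≤ C₀ * (1 + ‖x‖ + ∫ y, ‖y‖ ∂μ)) →
        (∀ x μ i k l, |σm x μ i k l| ≤ C₀) →
        ∀ (N : ℕ), 0 < N → ∀ (x : Fin N → EuclideanSpace ℝ (Fin d)) (i₀ : S),
          |(∑ i, ⟪b (x i) (empirical N x) i₀, blockGrad (lyapV d N p) x i⟫) +
              (1 / 2) * ∑ i, ∑ k, ∑ l,
                (σm (x i) (empirical N x) i₀ * (σm (x i) (empirical N x) i₀)ᵀ) k l *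
                  blockHess (lyapV d N p) x i l k| ≤
            C₁ * lyapV d N p x := by
  refine ⟨5 * C₀ + 3 * d ^ 3 * C₀ ^ 2, ?_⟩
  intro b σm hb hσ N hN x i₀
  have hN' : (0 : ℝ) < N := by exact_mod_cast hN
  have hV : lyapV d N p x = ((N : ℝ)⁻¹ * ∑ i, ‖x i‖ ^ 2 + 1) ^ p := rfl
  rw [hV]
  simp_rw [blockGrad_eq, blockHess_eq]
  set Q := (N : ℝ)⁻¹ * ∑ i, ‖x i‖ ^ 2 with hQ
  set A := Q + 1 with hA
  have hQ0 : 0 ≤ Q := by positivity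
  have hA1 : 1 ≤ A := by linarith
  have hA0 : 0 < A := by linarith
  set n := (N : ℝ)⁻¹ with hn
  have hn0 : 0 < n := by positivity
  have hnN : (N : ℝ) * n = 1 := by rw [hn]; field_simp
  set m := n * ∑ i, ‖x i‖ with hm
  have hm0 : 0 ≤ m := by positivity
  have hmQ : m ^ 2 ≤ Q := by
    have := sq_sum_le_card_mul_sum_sq (s := Finset.univ) (f := fun i => ‖x i‖)
    simp only [Finset.card_univ, Fintype.card_fin] at this
    calc m ^ 2 = n ^ 2 * (∑ i, ‖x i‖) ^ 2 := by rw [hm]; ring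
      _ ≤ n ^ 2 * (N * ∑ i, ‖x i‖ ^ 2) := by gcongr
      _ = (N * n) * Q := by rw [hQ]; ring
      _ = Q := by rw [hnN, one_mul]
  have hP1 : A ^ (p - 1) * A = A ^ p := by
    rw [← Real.rpow_add_one hA0.ne']; congr 1; ring
  have hP2 : A ^ (p - 2) * A = A ^ (p - 1) := by
    rw [← Real.rpow_add_one hA0.ne']; congr 1; ring
  have hB0 : 0 < A ^ (p - 1) := Real.rpow_pos_of_pos hA0 _
  have hD0 : 0 < A ^ (p - 2) := Real.rpow_pos_of_pos hA0 _
  have hBp : A ^ (p - 1) ≤ A ^ p := by nlinarith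
  have hAp : 0 < A ^ p := Real.rpow_pos_of_pos hA0 _
  have hbb : ∀ i, ‖b (x i) (empirical N x) i₀‖ ≤ C₀ * (1 + ‖x i‖ + m) := by
    intro i
    have := hb (x i) (empirical N x) i₀ (empirical_prob hN x) (empirical_integrable hN x)
    rwa [empirical_integral] at this
  have hxi : ∀ i, n * ‖x i‖ ^ 2 ≤ A := by
    intro i
    have : ‖x i‖ ^ 2 ≤ ∑ i, ‖x i‖ ^ 2 :=
      Finset.single_le_sum (f := fun i => ‖x i‖ ^ 2) (fun _ _ => by positivity)
        (Finset.mem_univ i)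
    have := mul_le_mul_of_nonneg_left this hn0.le
    linarith
  have hfirst : |∑ i, ⟪b (x i) (empirical N x) i₀, (p * A ^ (p - 1) * (2 * n)) • x i⟫|
      ≤ 5 * C₀ * A ^ p := by
    calc _ ≤ ∑ i, |⟪b (x i) (empirical N x) i₀, (p * A ^ (p - 1) * (2 * n)) • x i⟫| :=
          Finset.abs_sum_le_sum_abs _ _
      _ ≤ ∑ i, (A ^ (p - 1) * (2 * n)) * C₀ * (1 / 2 + 2 * ‖x i‖ ^ 2 + m ^ 2 / 2) := by
          apply Finset.sum_le_sum
          intro i _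
          rw [inner_smul_right, abs_mul, abs_of_pos (a := p * A ^ (p - 1) * (2 * n)) (by positivity)]
          have h1 : |⟪b (x i) (empirical N x) i₀, x i⟫| ≤
              C₀ * (1 / 2 + 2 * ‖x i‖ ^ 2 + m ^ 2 / 2) := by
            calc _ ≤ ‖b (x i) (empirical N x) i₀‖ * ‖x i‖ := abs_real_inner_le_norm _ _
              _ ≤ (C₀ * (1 + ‖x i‖ + m)) * ‖x i‖ := by gcongr; exact hbb i
              _ = C₀ * ((1 + ‖x i‖ + m) * ‖x i‖) := by ring
              _ ≤ _ := by
                gcongr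
                nlinarith [sq_nonneg (1 - ‖x i‖), sq_nonneg (m - ‖x i‖)]
          have h2 : p * A ^ (p - 1) * (2 * n) ≤ A ^ (p - 1) * (2 * n) := by
            gcongr
            nlinarith
          calc _ ≤ A ^ (p - 1) * (2 * n) * (C₀ * (1 / 2 + 2 * ‖x i‖ ^ 2 + m ^ 2 / 2)) := by gcongr
            _ = _ := by ring
      _ = A ^ (p - 1) * 2 * C₀ * ((N * n) / 2 + 2 * Q + (N * n) * m ^ 2 / 2) := by
          rw [← Finset.mul_sum]
          simp only [Finset.sum_add_distrib, ← Finset.mul_sum, Finset.sum_const, Finset.card_univ,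
            Fintype.card_fin, nsmul_eq_mul, hQ]
          ring
      _ ≤ A ^ (p - 1) * 2 * C₀ * (5 / 2 * A) := by
          rw [hnN]
          gcongr
          linarith
      _ = 5 * C₀ * (A ^ (p - 1) * A) := by ring
      _ = _ := by rw [hP1]
  have haa : ∀ i k l, |(σm (x i) (empirical N x) i₀ * (σm (x i) (empirical N x) i₀)ᵀ) k l|
      ≤ d * C₀ ^ 2 := by
    intro i k l
    rw [Matrix.mul_apply]
    calc _ ≤ ∑ j, |σm (x i) (empirical N x) i₀ k j * (σm (x i) (empirical N x) i₀)ᵀ j l| :=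
          Finset.abs_sum_le_sum_abs _ _
      _ ≤ ∑ j : Fin d, C₀ ^ 2 := by
          apply Finset.sum_le_sum
          intro j _
          rw [abs_mul, Matrix.transpose_apply, sq]
          exact mul_le_mul (hσ _ _ _ _ _) (hσ _ _ _ _ _) (abs_nonneg _) hC₀.le
      _ = _ := by simp
  have hhess : ∀ i k l, |p * A ^ (p - 1) * (2 * n) * (if l = k then 1 else 0)
      + p * (p - 1) * A ^ (p - 2) * (2 * n) ^ 2 * (x i l * x i k)| ≤ 6 * n * A ^ p := by
    intro i k l
    have hk : ∀ k, |x i k| ≤ ‖x i‖ := fun k => by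
      simpa using PiLp.norm_apply_le (x i) k
    have h1 : |p * A ^ (p - 1) * (2 * n) * (if l = k then 1 else 0)| ≤ 2 * n * A ^ p := by
      have : |(if l = k then (1 : ℝ) else 0)| ≤ 1 := by split_ifs <;> simp
      rw [abs_mul, abs_of_pos (a := p * A ^ (p - 1) * (2 * n)) (by positivity)]
      calc _ ≤ 1 * A ^ p * (2 * n) * 1 := by gcongr
        _ = _ := by ring
    have h2 : |p * (p - 1) * A ^ (p - 2) * (2 * n) ^ 2 * (x i l * x i k)| ≤ 4 * n * A ^ p := by
      have hpp : |p * (p - 1)| ≤ 1 := by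
        rw [abs_le]; constructor <;> nlinarith
      rw [abs_mul, abs_mul, abs_mul, abs_of_pos hD0, abs_of_nonneg (sq_nonneg (2 * n)), abs_mul (x i l)]
      calc _ ≤ 1 * A ^ (p - 2) * (2 * n) ^ 2 * (‖x i‖ * ‖x i‖) := by
            gcongr
            · exact hk l
            · exact hk k
        _ = 4 * n * (A ^ (p - 2) * (n * ‖x i‖ ^ 2)) := by ring
        _ ≤ 4 * n * (A ^ (p - 2) * A) := by gcongr; exact hxi i
        _ = 4 * n * A ^ (p - 1) := by rw [hP2]
        _ ≤ _ := by gcongr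
    calc _ ≤ _ := abs_add_le _ _
      _ ≤ 2 * n * A ^ p + 4 * n * A ^ p := add_le_add h1 h2
      _ = _ := by ring
  have hsecond : |∑ i, ∑ k, ∑ l,
      (σm (x i) (empirical N x) i₀ * (σm (x i) (empirical N x) i₀)ᵀ) k l *
      (p * A ^ (p - 1) * (2 * n) * (if l = k then 1 else 0)
      + p * (p - 1) * A ^ (p - 2) * (2 * n) ^ 2 * (x i l * x i k))| ≤ 6 * d ^ 3 * C₀ ^ 2 * A ^ p := by
    calc _ ≤ ∑ i : Fin N, ∑ k : Fin d, ∑ l : Fin d, (d * C₀ ^ 2) * (6 * n * A ^ p) := by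
          refine (Finset.abs_sum_le_sum_abs _ _).trans (Finset.sum_le_sum fun i _ => ?_)
          refine (Finset.abs_sum_le_sum_abs _ _).trans (Finset.sum_le_sum fun k _ => ?_)
          refine (Finset.abs_sum_le_sum_abs _ _).trans (Finset.sum_le_sum fun l _ => ?_)
          rw [abs_mul]
          exact mul_le_mul (haa i k l) (hhess i k l) (abs_nonneg _) (by positivity)
      _ = (N * n) * (6 * d ^ 3 * C₀ ^ 2 * A ^ p) := by
          simp only [Finset.sum_const, Finset.card_univ, Fintype.card_fin, nsmul_eq_mul]
          ring
      _ = _ := by rw [hnN, one_mul]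
  refine (abs_add_le _ _).trans ?_
  rw [abs_mul, abs_of_pos (by norm_num : (0 : ℝ) < 1 / 2)]
  linarith
end

section
/- Let S be a finite set, T > 0, and Q = (q(i,j))_{i,j∈S} a generator matrix (q(i,j) ≥ 0 for i ≠ j and q(i,i) = −∑_{j≠i} q(i,j)). Let b : ℝ^d × P(ℝ^d) × S → ℝ^d and σ : ℝ^d × P(ℝ^d) × S → ℝ^{d×d} be continuous, with |b(x,μ,i)| ≤ C₀(1 + |x| + ∫|y|dμ(y)) and |σ(x,μ,i)| ≤ C₀, and set a = σσᵀ. For f with f(·,i) ∈ C²_c(ℝ^d) for each i ∈ S, define L(μ)f(x,i) = b(x,μ,i)·∇_x f(x,i) + (1/2)trace(a(x,μ,i) Hess_x f(x,i)) + ∑_{j∈S} q(i,j)(f(x,j) − f(x,i)), and define L̂_i(μ)h(x) = b(x,μ,i)·∇h(x) + (1/2)trace(a(x,μ,i) Hess h(x)) for h ∈ C²_c(ℝ^d). Let ς : [0,T] → S be right-continuous piecewise constant with jump times 0 = t_0 < t_1 < … < t_m ≤ T and values ι_k on [t_k, t_{k+1}), and let M^ς_{ij} be the associated explicit martingale paths.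 Let η : [0,T] → P(ℝ^d) be such that s ↦ ∫ h dη(s) is measurable for every bounded continuous h and sup_{s∈[0,T]} ∫|x| dη(s)(x) < ∞. Assume that for every f with f(·,i) ∈ C²_c(ℝ^d) for each i ∈ S and every t ∈ [0,T]: ∫ f(x, ς(t)) dη(t)(x) = ∫ f(x, ς(0)) dη(0)(x) + ∫_0^t ( ∫ L(η(s))f(x, ς(s_-)) dη(s)(x) ) ds + ∑_{i≠j} ∫_0^t ( ∫ (f(x,j) − f(x,i)) dη(s)(x) ) dM^ς_{ij}(s). Then for every k ∈ {1, …, m+1}, every h ∈ C²_c(ℝ^d), and every t ∈ [t_{k−1}, min(t_k, T)]: ∫ h dη(t) = ∫ h dη(t_{k−1}) + ∫_{t_{k−1}}^{t} ( ∫ L̂_{ι_{k−1}}(η(s))h(x) dη(s)(x) ) ds. -/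
open MeasureTheory Matrix
open scoped ENNReal NNReal RealInnerProductSpace

/-- The diffusion part of the generator:
`L̂_i(μ)h(x) = b(x,μ,i)·∇h(x) + (1/2) trace(a(x,μ,i) Hess h(x))` with `a = σσᵀ`. -/
noncomputable def Lhat {d : ℕ} {S : Type*}
    (b : EuclideanSpace ℝ (Fin d) → ProbabilityMeasure (EuclideanSpace ℝ (Fin d)) → S →
      EuclideanSpace ℝ (Fin d))
    (σm : EuclideanSpace ℝ (Fin d) → ProbabilityMeasure (EuclideanSpace ℝ (Fin d)) → S →
      Matrix (Fin d) (Fin d) ℝ)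
    (i : S) (μ : ProbabilityMeasure (EuclideanSpace ℝ (Fin d)))
    (h : EuclideanSpace ℝ (Fin d) → ℝ) (x : EuclideanSpace ℝ (Fin d)) : ℝ :=
  ⟪b x μ i, gradient h x⟫ + (1 / 2) * ∑ k, ∑ l,
    (σm x μ i * (σm x μ i)ᵀ) k l *
      fderiv ℝ (fun v => fderiv ℝ h v (EuclideanSpace.single l (1:ℝ))) x
        (EuclideanSpace.single k (1:ℝ))

/-- The integral `∫_r^τ c dM^ς_{ij}` against the explicit martingale path. -/
noncomputable def stochInt {S : Type*} [DecidableEq S] (q : S → S → ℝ) (m : ℕ)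
    (t : ℕ → ℝ) (ι : ℕ → S) (ς : ℝ → S) (i j : S) (c : ℝ → ℝ) (r τ : ℝ) : ℝ :=
  (∑ k ∈ (Finset.Icc 1 m).filter
      (fun k => r < t k ∧ t k ≤ τ ∧ ι (k - 1) = i ∧ ι k = j), c (t k)) -
    q i j * ∫ s in r..τ, Set.indicator {s' | ς s' = i} c s


open Filter Topology ProbabilityTheory in
lemma aux_kernel {E : Type*} [PseudoEMetricSpace E] [MeasurableSpace E] [BorelSpace E]
    (η : ℝ → ProbabilityMeasure E)
    (hηm : ∀ h : BoundedContinuousFunction E ℝ,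
      Measurable (fun s => ∫ x, h x ∂(η s).toMeasure)) :
    Measurable (fun s => (η s).toMeasure) := by
  refine Measurable.measure_of_isPiSystem_of_isProbabilityMeasure
    (S := {F : Set E | IsClosed F}) ?_ isPiSystem_isClosed ?_
  · rw [‹BorelSpace E›.measurable_eq, borel_eq_generateFrom_isClosed]
  · intro F hF
    have hF : IsClosed F := hF
    refine measurable_of_tendsto_metrizable (f := fun n s => ∫⁻ x, hF.apprSeq n x ∂(η s).toMeasure)
      ?_ ?_
    · intro n
      let g : BoundedContinuousFunction E ℝ :=
        BoundedContinuousFunction.ofNormedAddCommGroup (fun x => (hF.apprSeq n x : ℝ))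
          (by fun_prop) 1 (by
            intro x
            have := HasOuterApproxClosed.apprSeq_apply_le_one hF n x
            simpa using this)
      have h1 := (hηm g).ennreal_ofReal
      convert h1 using 1
      funext s
      symm
      rw [ofReal_integral_eq_lintegral_ofReal (g.integrable _) (ae_of_all _ fun x => by
        change (0:ℝ) ≤ (hF.apprSeq n x : ℝ); positivity)]
      refine lintegral_congr fun x => ?_
      change ENNReal.ofReal (hF.apprSeq n x : ℝ) = _
      simp
    · rw [tendsto_pi_nhds]
      intro s
      exact HasOuterApproxClosed.tendsto_lintegral_apprSeq hF (η s).toMeasure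

noncomputable def auxPhi {E : Type*} [MeasurableSpace E] (R : Finset E)
    (w : stdSimplex ℝ R) : ProbabilityMeasure E :=
  ⟨∑ r : R, ENNReal.ofReal (w.1 r) • Measure.dirac (r : E), ⟨by
    simp only [Measure.coe_finsetSum, Finset.sum_apply, Measure.smul_apply, measure_univ,
      smul_eq_mul, mul_one]
    rw [← ENNReal.ofReal_sum_of_nonneg (fun i _ => w.2.1 i), w.2.2, ENNReal.ofReal_one]⟩⟩

lemma auxPhi_integral {E : Type*} [PseudoMetricSpace E] [MeasurableSpace E] [BorelSpace E]
    (R : Finset E) (w : stdSimplex ℝ R) (h : BoundedContinuousFunction E ℝ) :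
    ∫ x, h x ∂(auxPhi R w).toMeasure = ∑ r : R, w.1 r * h r := by
  change ∫ x, h x ∂(∑ r : R, ENNReal.ofReal (w.1 r) • Measure.dirac (r : E)) = _
  have hd : ∀ r : E, ∫ x, h x ∂(Measure.dirac r) = h r := fun r =>
    integral_dirac' _ _ h.continuous.measurable.stronglyMeasurable
  rw [integral_finsetSum_measure]
  · refine Finset.sum_congr rfl fun r _ => ?_
    rw [integral_smul_measure, hd, ENNReal.toReal_ofReal (w.2.1 r), smul_eq_mul]
  · intro r _
    exact (h.integrable _).smul_measure ENNReal.ofReal_ne_top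

open Filter Topology ProbabilityTheory in
lemma aux_comp {E : Type*} [MetricSpace E] [MeasurableSpace E] [BorelSpace E]
    [TopologicalSpace.SeparableSpace E] [Nonempty E]
    (η : ℝ → ProbabilityMeasure E)
    (hη : Measurable (fun s => (η s).toMeasure))
    (F : ProbabilityMeasure E → ℝ) (hF : Continuous F) :
    Measurable (fun s => F (η s)) := by
  classical
  obtain ⟨y₀⟩ := ‹Nonempty E›
  let φ : ℕ → SimpleFunc E E := SimpleFunc.approxOn id measurable_id Set.univ y₀ (Set.mem_univ _)
  have hφ : ∀ x, Tendsto (fun n => φ n x) atTop (𝓝 x) := fun x =>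
    SimpleFunc.tendsto_approxOn measurable_id (Set.mem_univ y₀) (by simp)
  have hsum : ∀ n s (h : E → ℝ), ∑ r : (φ n).range, (η s).toMeasure.real (φ n ⁻¹' {(r:E)}) * h r
      = ∫ x, h (φ n x) ∂(η s).toMeasure := by
    intro n s h
    have : ∀ x, h (φ n x) = ∑ r ∈ (φ n).range, Set.indicator (φ n ⁻¹' {r}) (fun _ => h r) x := by
      intro x
      rw [Finset.sum_eq_single (φ n x)]
      · simp
      · intro b _ hb
        simp [Set.indicator, hb.symm]
      · intro hx
        exact absurd ((φ n).mem_range_self x) hx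
    simp_rw [this]
    rw [integral_finsetSum]
    · rw [← Finset.sum_coe_sort (φ n).range]
      refine Finset.sum_congr rfl fun r _ => ?_
      rw [integral_indicator_const _ ((φ n).measurableSet_fiber _), smul_eq_mul]
    · intro r _
      exact (integrable_const _).indicator ((φ n).measurableSet_fiber _)
  let w : ∀ n, ℝ → stdSimplex ℝ (φ n).range := fun n s =>
    ⟨fun r => (η s).toMeasure.real (φ n ⁻¹' {(r:E)}), fun r => measureReal_nonneg, by
      have := hsum n s (fun _ => 1)
      simpa using this⟩
  refine measurable_of_tendsto_metrizable (f := fun n s => F (auxPhi _ (w n s))) ?_ ?_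
  · intro n
    have hw : Measurable (w n) := by
      refine Measurable.subtype_mk (measurable_pi_iff.2 fun r => ?_)
      exact ((Measure.measurable_coe ((φ n).measurableSet_fiber _)).comp hη).ennreal_toReal
    have hc : Continuous (fun v : stdSimplex ℝ (φ n).range => F (auxPhi _ v)) := by
      refine hF.comp ?_
      rw [continuous_iff_continuousAt]
      intro v
      refine ProbabilityMeasure.tendsto_iff_forall_integral_tendsto.2 fun h => ?_
      simp_rw [auxPhi_integral]
      have : Continuous (fun v : stdSimplex ℝ (φ n).range => ∑ r, v.1 r * h r) := by
        refine continuous_finsetSum _ fun r _ => ?_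
        exact ((continuous_apply r).comp continuous_subtype_val).mul continuous_const
      exact this.continuousAt
    exact hc.measurable.comp hw
  · rw [tendsto_pi_nhds]
    intro s
    refine (hF.tendsto _).comp ?_
    refine ProbabilityMeasure.tendsto_iff_forall_integral_tendsto.2 fun h => ?_
    simp_rw [auxPhi_integral]
    have : ∀ n, ∑ r, (w n s).1 r * h r = ∫ x, h (φ n x) ∂(η s).toMeasure := fun n => hsum n s h
    simp_rw [this]
    refine tendsto_integral_of_dominated_convergence (fun _ => ‖h‖) ?_ (integrable_const _) ?_ ?_
    · intro n
      exact (h.continuous.measurable.comp (φ n).measurable).aestronglyMeasurable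
    · intro n
      exact ae_of_all _ fun x => h.norm_coe_le_norm _
    · exact ae_of_all _ fun x => (h.continuous.tendsto x).comp (hφ x)

open Filter Topology ProbabilityTheory in
lemma aux_meas {E : Type*} [MetricSpace E] [MeasurableSpace E] [BorelSpace E]
    [TopologicalSpace.SeparableSpace E] [Nonempty E]
    (η : ℝ → ProbabilityMeasure E)
    (hηm : ∀ h : BoundedContinuousFunction E ℝ,
      Measurable (fun s => ∫ x, h x ∂(η s).toMeasure))
    (g : E → ProbabilityMeasure E → ℝ)
    (hg : Continuous (fun p : E × ProbabilityMeasure E => g p.1 p.2)) :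
    StronglyMeasurable (fun s => ∫ x, g x (η s) ∂(η s).toMeasure) := by
  have : SecondCountableTopology E := UniformSpace.secondCountable_of_separable E
  have hη := aux_kernel η hηm
  let κ : Kernel ℝ E := ⟨fun s => (η s).toMeasure, hη⟩
  have : IsMarkovKernel κ := ⟨fun s => by
    change IsProbabilityMeasure (η s).toMeasure
    infer_instance⟩
  have h1 : Measurable (Function.uncurry fun (x : E) (s : ℝ) => g x (η s)) := by
    refine measurable_uncurry_of_continuous_of_measurable ?_ ?_
    · intro s
      exact hg.comp (by fun_prop : Continuous fun x : E => (x, η s))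
    · intro x
      exact aux_comp η hη (fun μ => g x μ) 
        (hg.comp (by fun_prop : Continuous fun μ : ProbabilityMeasure E => (x, μ)))
  exact StronglyMeasurable.integral_kernel_prod_right (κ := κ) (f := fun s x => g x (η s))
    (h1.comp measurable_swap).stronglyMeasurable

lemma aux_D2 {d : ℕ} (h : EuclideanSpace ℝ (Fin d) → ℝ) (hh : ContDiff ℝ 2 h)
    (k l : Fin d) : Continuous (fun x =>
      fderiv ℝ (fun v => fderiv ℝ h v (EuclideanSpace.single l (1:ℝ))) x
        (EuclideanSpace.single k (1:ℝ))) := by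
  have h1 : ContDiff ℝ 1 (fun v => fderiv ℝ h v (EuclideanSpace.single l (1:ℝ))) :=
    (hh.fderiv_right (m := 1) (by norm_num)).clm_apply contDiff_const
  exact (h1.continuous_fderiv (by norm_num)).clm_apply continuous_const

lemma aux_grad {d : ℕ} (h : EuclideanSpace ℝ (Fin d) → ℝ) (hh : ContDiff ℝ 2 h) :
    Continuous (gradient h) :=
  (InnerProductSpace.toDual ℝ (EuclideanSpace ℝ (Fin d))).symm.continuous.comp
    (hh.continuous_fderiv (by norm_num))

lemma aux_gradc {d : ℕ} (h : EuclideanSpace ℝ (Fin d) → ℝ) (hc : HasCompactSupport h) :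
    HasCompactSupport (gradient h) :=
  (hc.fderiv (𝕜 := ℝ)).comp_left
    (g := (InnerProductSpace.toDual ℝ (EuclideanSpace ℝ (Fin d))).symm) (map_zero _)

lemma aux_D2c {d : ℕ} (h : EuclideanSpace ℝ (Fin d) → ℝ) (hc : HasCompactSupport h)
    (k l : Fin d) : HasCompactSupport (fun x =>
      fderiv ℝ (fun v => fderiv ℝ h v (EuclideanSpace.single l (1:ℝ))) x
        (EuclideanSpace.single k (1:ℝ))) := by
  have h1 : HasCompactSupport (fun v => fderiv ℝ h v (EuclideanSpace.single l (1:ℝ))) :=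
    hc.fderiv_apply (𝕜 := ℝ) _
  exact h1.fderiv_apply (𝕜 := ℝ) _

lemma aux_Lcont {d : ℕ} {S : Type*}
    (b : EuclideanSpace ℝ (Fin d) → ProbabilityMeasure (EuclideanSpace ℝ (Fin d)) → S →
      EuclideanSpace ℝ (Fin d))
    (σm : EuclideanSpace ℝ (Fin d) → ProbabilityMeasure (EuclideanSpace ℝ (Fin d)) → S →
      Matrix (Fin d) (Fin d) ℝ)
    (hbc : ∀ i, Continuous (fun p : EuclideanSpace ℝ (Fin d) ×
      ProbabilityMeasure (EuclideanSpace ℝ (Fin d)) => b p.1 p.2 i))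
    (hσc : ∀ i k l, Continuous (fun p : EuclideanSpace ℝ (Fin d) ×
      ProbabilityMeasure (EuclideanSpace ℝ (Fin d)) => σm p.1 p.2 i k l))
    (i : S) (h : EuclideanSpace ℝ (Fin d) → ℝ) (hh : ContDiff ℝ 2 h) :
    Continuous (fun p : EuclideanSpace ℝ (Fin d) ×
      ProbabilityMeasure (EuclideanSpace ℝ (Fin d)) => Lhat b σm i p.2 h p.1) := by
  unfold Lhat
  refine ((hbc i).inner ((aux_grad h hh).comp continuous_fst)).add (continuous_const.mul ?_)
  refine continuous_finsetSum _ fun k _ => continuous_finsetSum _ fun l _ => ?_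
  refine Continuous.mul ?_ ((aux_D2 h hh k l).comp continuous_fst)
  simp only [Matrix.mul_apply, Matrix.transpose_apply]
  exact continuous_finsetSum _ fun n _ => (hσc i k n).mul (hσc i l n)

lemma aux_Lbound {d : ℕ} {S : Type*} (T : ℝ) (C₀ : ℝ) (hC₀ : 0 < C₀)
    (b : EuclideanSpace ℝ (Fin d) → ProbabilityMeasure (EuclideanSpace ℝ (Fin d)) → S →
      EuclideanSpace ℝ (Fin d))
    (σm : EuclideanSpace ℝ (Fin d) → ProbabilityMeasure (EuclideanSpace ℝ (Fin d)) → S →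
      Matrix (Fin d) (Fin d) ℝ)
    (hbgrowth : ∀ x μ i, Integrable (fun y => ‖y‖) μ.toMeasure →
      ‖b x μ i‖ ≤ C₀ * (1 + ‖x‖ + ∫ y, ‖y‖ ∂μ.toMeasure))
    (hσb : ∀ x μ i k l, |σm x μ i k l| ≤ C₀)
    (η : ℝ → ProbabilityMeasure (EuclideanSpace ℝ (Fin d)))
    (B : ℝ) (hηmom : ∀ s ∈ Set.Icc (0:ℝ) T,
      (∫⁻ x, (‖x‖₊ : ℝ≥0∞) ∂(η s).toMeasure) ≤ ENNReal.ofReal B)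
    (i : S) (h : EuclideanSpace ℝ (Fin d) → ℝ) (hh : ContDiff ℝ 2 h)
    (hc : HasCompactSupport h) :
    ∃ C : ℝ, ∀ s ∈ Set.Icc (0:ℝ) T, ∀ x, ‖Lhat b σm i (η s) h x‖ ≤ C := by
  obtain ⟨C1, hC1⟩ := (aux_gradc h hc).exists_bound_of_continuous (aux_grad h hh)
  obtain ⟨C2, hC2⟩ := ((aux_gradc h hc).smul_left (f := fun x => ‖x‖)).exists_bound_of_continuous
    (continuous_norm.smul (aux_grad h hh))
  choose D hD using fun k l => (aux_D2c h hc k l).exists_bound_of_continuous (aux_D2 h hh k l)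
  refine ⟨C₀ * ((1 + max B 0) * C1 + C2) + (1/2) * ∑ k, ∑ l, (∑ _n : Fin d, C₀ * C₀) * D k l, ?_⟩
  intro s hs x
  have hint : Integrable (fun y : EuclideanSpace ℝ (Fin d) => ‖y‖) (η s).toMeasure := by
    refine ⟨by fun_prop, ?_⟩
    refine lt_of_le_of_lt ?_ ((hηmom s hs).trans_lt ENNReal.ofReal_lt_top)
    refine lintegral_mono fun y => ?_
    simp [enorm]
  have hB : ∫ y, ‖y‖ ∂(η s).toMeasure ≤ max B 0 := by
    rw [integral_norm_eq_lintegral_enorm (by fun_prop)]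
    refine ENNReal.toReal_le_of_le_ofReal (le_max_right _ _) ?_
    exact (hηmom s hs).trans (ENNReal.ofReal_le_ofReal (le_max_left _ _))
  unfold Lhat
  refine (norm_add_le _ _).trans (add_le_add ?_ ?_)
  · refine (norm_inner_le_norm _ _).trans ?_
    have h1 := hbgrowth x (η s) i hint
    have h2 := hC1 x
    have h3 := hC2 x
    simp only [Pi.smul_apply', smul_eq_mul, norm_smul, norm_norm] at h3
    have h4 := norm_nonneg (gradient h x)
    have h5 : 0 ≤ max B 0 := le_max_right _ _
    calc _ ≤ C₀ * (1 + ‖x‖ + max B 0) * ‖gradient h x‖ := by gcongr; exact h1.trans (by gcongr)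
      _ = C₀ * ((1 + max B 0) * ‖gradient h x‖ + ‖x‖ * ‖gradient h x‖) := by ring
      _ ≤ _ := by gcongr
  · rw [norm_mul]
    have : ‖(1/2:ℝ)‖ = 1/2 := by norm_num
    rw [this]
    gcongr
    refine (norm_sum_le _ _).trans (Finset.sum_le_sum fun k _ => ?_)
    refine (norm_sum_le _ _).trans (Finset.sum_le_sum fun l _ => ?_)
    rw [norm_mul]
    refine mul_le_mul ?_ (hD k l x) (norm_nonneg _) (Finset.sum_nonneg fun _ _ => by positivity)
    rw [Matrix.mul_apply]
    refine (norm_sum_le _ _).trans (Finset.sum_le_sum fun n _ => ?_)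
    rw [norm_mul]
    exact mul_le_mul (hσb _ _ _ _ _) (hσb _ _ _ _ _) (norm_nonneg _) hC₀.le

theorem stmt13 {d : ℕ} {S : Type*} [Fintype S] [DecidableEq S] (T : ℝ) (hT : 0 < T)
    (q : S → S → ℝ) (hq1 : ∀ i j, i ≠ j → 0 ≤ q i j)
    (hq2 : ∀ i, q i i = -∑ j ∈ Finset.univ.filter (fun j => j ≠ i), q i j)
    (C₀ : ℝ) (hC₀ : 0 < C₀)
    (b : EuclideanSpace ℝ (Fin d) → ProbabilityMeasure (EuclideanSpace ℝ (Fin d)) → S →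
      EuclideanSpace ℝ (Fin d))
    (σm : EuclideanSpace ℝ (Fin d) → ProbabilityMeasure (EuclideanSpace ℝ (Fin d)) → S →
      Matrix (Fin d) (Fin d) ℝ)
    (hbc : ∀ i, Continuous (fun p : EuclideanSpace ℝ (Fin d) ×
      ProbabilityMeasure (EuclideanSpace ℝ (Fin d)) => b p.1 p.2 i))
    (hσc : ∀ i k l, Continuous (fun p : EuclideanSpace ℝ (Fin d) ×
      ProbabilityMeasure (EuclideanSpace ℝ (Fin d)) => σm p.1 p.2 i k l))
    (hbgrowth : ∀ x μ i, Integrable (fun y => ‖y‖) μ.toMeasure →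
      ‖b x μ i‖ ≤ C₀ * (1 + ‖x‖ + ∫ y, ‖y‖ ∂μ.toMeasure))
    (hσb : ∀ x μ i k l, |σm x μ i k l| ≤ C₀)
    -- the switching path
    (m : ℕ) (t : ℕ → ℝ) (ι : ℕ → S) (ς : ℝ → S)
    (ht0 : t 0 = 0) (htmono : ∀ k < m, t k < t (k + 1)) (htm : t m ≤ T)
    (hς : ∀ k < m, ∀ s, t k ≤ s → s < t (k + 1) → ς s = ι k)
    (hςlast : ∀ s, t m ≤ s → s ≤ T → ς s = ι m)
    -- the measure-valued path
    (η : ℝ → ProbabilityMeasure (EuclideanSpace ℝ (Fin d)))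
    (hηm : ∀ h : BoundedContinuousFunction (EuclideanSpace ℝ (Fin d)) ℝ,
      Measurable (fun s => ∫ x, h x ∂(η s).toMeasure))
    (B : ℝ) (hηmom : ∀ s ∈ Set.Icc (0:ℝ) T,
      (∫⁻ x, (‖x‖₊ : ℝ≥0∞) ∂(η s).toMeasure) ≤ ENNReal.ofReal B)
    -- the McKean–Vlasov identity with switching for all test functions `f(·, i) ∈ C²_c`
    (hMKV : ∀ f : EuclideanSpace ℝ (Fin d) → S → ℝ,
      (∀ i, ContDiff ℝ 2 (fun x => f x i)) → (∀ i, HasCompactSupport (fun x => f x i)) →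
      ∀ τ ∈ Set.Icc (0:ℝ) T,
        (∫ x, f x (ς τ) ∂(η τ).toMeasure) = (∫ x, f x (ς 0) ∂(η 0).toMeasure) +
          (∫ s in (0:ℝ)..τ, ∫ x,
            (Lhat b σm (ς s) (η s) (fun y => f y (ς s)) x +
              ∑ j, q (ς s) j * (f x j - f x (ς s))) ∂(η s).toMeasure) +
          (∑ i : S, ∑ j ∈ Finset.univ.filter (fun j => j ≠ i),
            stochInt q m t ι ς i j
              (fun s => ∫ x, (f x j - f x i) ∂(η s).toMeasure) 0 τ)) :
    -- between consecutive jump times the path solves the McKean–Vlasov equation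
    -- without switching, driven by the frozen operator `L̂_{ι_{k-1}}`
    (∀ k < m, ∀ h : EuclideanSpace ℝ (Fin d) → ℝ, ContDiff ℝ 2 h → HasCompactSupport h →
      ∀ τ ∈ Set.Icc (t k) (t (k + 1)),
        (∫ x, h x ∂(η τ).toMeasure) = (∫ x, h x ∂(η (t k)).toMeasure) +
          ∫ s in (t k)..τ, ∫ x, Lhat b σm (ι k) (η s) h x ∂(η s).toMeasure) ∧
    (∀ h : EuclideanSpace ℝ (Fin d) → ℝ, ContDiff ℝ 2 h → HasCompactSupport h →
      ∀ τ ∈ Set.Icc (t m) T,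
        (∫ x, h x ∂(η τ).toMeasure) = (∫ x, h x ∂(η (t m)).toMeasure) +
          ∫ s in (t m)..τ, ∫ x, Lhat b σm (ι m) (η s) h x ∂(η s).toMeasure) := by
  -- the identity for test functions not depending on the regime
  have hkey : ∀ h : EuclideanSpace ℝ (Fin d) → ℝ, ContDiff ℝ 2 h → HasCompactSupport h →
      ∀ τ ∈ Set.Icc (0:ℝ) T, (∫ x, h x ∂(η τ).toMeasure) = (∫ x, h x ∂(η 0).toMeasure) +
        ∫ s in (0:ℝ)..τ, ∫ x, Lhat b σm (ς s) (η s) h x ∂(η s).toMeasure := by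
    intro h hh hc τ hτ
    have := hMKV (fun x _ => h x) (fun _ => hh) (fun _ => hc) τ hτ
    simpa [stochInt] using this
  have hI : ∀ h : EuclideanSpace ℝ (Fin d) → ℝ, ContDiff ℝ 2 h → HasCompactSupport h →
      ∀ i a c, 0 ≤ a → a ≤ c → c ≤ T → IntervalIntegrable
        (fun s => ∫ x, Lhat b σm i (η s) h x ∂(η s).toMeasure) volume a c := by
    intro h hh hc i a c ha hac hcT
    obtain ⟨C, hC⟩ := aux_Lbound T C₀ hC₀ b σm hbgrowth hσb η B hηmom i h hh hc
    have hm := aux_meas η hηm (fun x μ => Lhat b σm i μ h x) (aux_Lcont b σm hbc hσc i h hh)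
    refine (intervalIntegrable_const (c := C)).mono_fun' hm.aestronglyMeasurable ?_
    rw [Set.uIoc_of_le hac]
    refine (ae_restrict_iff' measurableSet_Ioc).2 (ae_of_all _ fun s hs => ?_)
    refine (norm_integral_le_of_norm_le_const (C := C) (ae_of_all _ fun x =>
      hC s ⟨ha.trans hs.1.le, hs.2.trans hcT⟩ x)).trans (by simp)
  have hstep : ∀ h : EuclideanSpace ℝ (Fin d) → ℝ, ContDiff ℝ 2 h → HasCompactSupport h →
      ∀ i a c, 0 ≤ a → a ≤ c → c ≤ T → (∀ s, a ≤ s → s < c → ς s = i) → IntervalIntegrable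
        (fun s => ∫ x, Lhat b σm (ς s) (η s) h x ∂(η s).toMeasure) volume a c := by
    intro h hh hc i a c ha hac hcT hsi
    refine (hI h hh hc i a c ha hac hcT).congr_uIoo ?_
    rw [Set.uIoo_of_le hac]
    intro s hs
    simp only [hsi s hs.1.le hs.2]
  have hle : ∀ k ≤ m, ∀ l ≤ k, t l ≤ t k := by
    intro k
    induction k with
    | zero => intro _ l hl; simp [Nat.le_zero.1 hl]
    | succ k ih =>
      intro hk l hl
      rcases Nat.lt_or_eq_of_le hl with h1 | h1
      · exact (ih (by omega) l (by omega)).trans (htmono k (by omega)).le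
      · rw [h1]
  have hnn : ∀ k ≤ m, 0 ≤ t k := fun k hk => ht0 ▸ hle k hk 0 (by omega)
  have hltT : ∀ k ≤ m, t k ≤ T := fun k hk => (hle m le_rfl k hk).trans htm
  have hpre : ∀ h : EuclideanSpace ℝ (Fin d) → ℝ, ContDiff ℝ 2 h → HasCompactSupport h →
      ∀ k ≤ m, IntervalIntegrable
        (fun s => ∫ x, Lhat b σm (ς s) (η s) h x ∂(η s).toMeasure) volume 0 (t k) := by
    intro h hh hc k hk
    rw [← ht0]
    refine IntervalIntegrable.trans_iterate fun l hl => ?_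
    exact hstep h hh hc (ι l) _ _ (hnn l (by omega)) (htmono l (by omega)).le
      (hltT _ (by omega)) (hς l (by omega))
  have hfin : ∀ h : EuclideanSpace ℝ (Fin d) → ℝ, ContDiff ℝ 2 h → HasCompactSupport h →
      ∀ k ≤ m, ∀ τ, t k ≤ τ → τ ≤ T → (∀ s, t k ≤ s → s < τ → ς s = ι k) →
        (∫ x, h x ∂(η τ).toMeasure) = (∫ x, h x ∂(η (t k)).toMeasure) +
          ∫ s in (t k)..τ, ∫ x, Lhat b σm (ι k) (η s) h x ∂(η s).toMeasure := by
    intro h hh hc k hk τ h1 h2 h3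
    have e1 := hkey h hh hc τ ⟨(hnn k hk).trans h1, h2⟩
    have e2 := hkey h hh hc (t k) ⟨hnn k hk, hltT k hk⟩
    have e3 := intervalIntegral.integral_add_adjacent_intervals (hpre h hh hc k hk)
      (hstep h hh hc (ι k) _ _ (hnn k hk) h1 h2 h3)
    have e4 : ∫ s in (t k)..τ, ∫ x, Lhat b σm (ς s) (η s) h x ∂(η s).toMeasure
        = ∫ s in (t k)..τ, ∫ x, Lhat b σm (ι k) (η s) h x ∂(η s).toMeasure := by
      refine intervalIntegral.integral_congr_Ioo_of_le h1 fun s hs => ?_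
      simp only [h3 s hs.1.le hs.2]
    rw [e1, e2, ← e3, e4]
    ring
  refine ⟨fun k hk h hh hc τ hτ => ?_, fun h hh hc τ hτ => ?_⟩
  · exact hfin h hh hc k hk.le τ hτ.1 (hτ.2.trans (hltT _ (by omega)))
      (fun s hs1 hs2 => hς k hk s hs1 (hs2.trans_le hτ.2))
  · exact hfin h hh hc m le_rfl τ hτ.1 hτ.2 (fun s hs1 hs2 => hςlast s hs1 (hs2.le.trans hτ.2))
end
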